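/- arXiv:1311.6248 — 8 statements merged into one kernel-verified Lean document; each statement's English description precedes it below -/
import Mathlib

section
/- If z = (z_Q, z_RD, z_RC) is a fluid solution whose initial state has all three components nonnegative, then z_Q(t) ≥ 0, z_RD(t) ≥ 0 and z_RC(t) ≥ 0 for all t ≥ 0; that is, the nonnegative octant is invariant for the fluid dynamics. -/
/-- The fluid drift map of the call-center fluid model with redials and reconnects. -/
noncomputable def fluidDrift (lam s mu th p q dRD dRC : ℝ) :
    ℝ × ℝ × ℝ → ℝ × ℝ × ℝ :=
  fun z =>
    (lam + dRD * z.2.1 + dRC * z.2.2 - mu * min s z.1 - th * max (z.1 - s) 0,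
     p * th * max (z.1 - s) 0 - dRD * z.2.1,
     q * mu * min s z.1 - dRC * z.2.2)

/-- A fluid solution: a function continuous on `[0, ∞)` satisfying the integral equation
`z(t) = z(0) + ∫₀ᵗ H(z(u)) du` for all `t ≥ 0`. -/
def IsFluidSolution (lam s mu th p q dRD dRC : ℝ) (z : ℝ → ℝ × ℝ × ℝ) : Prop :=
  ContinuousOn z (Set.Ici 0) ∧
    ∀ t : ℝ, 0 ≤ t →
      z t = z 0 + ∫ u in (0:ℝ)..t, fluidDrift lam s mu th p q dRD dRC (z u)

/-- The square of the negative part is differentiable. -/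
lemma hasDerivAt_min_zero_sq (x : ℝ) :
    HasDerivAt (fun y : ℝ => (min y 0) ^ 2) (2 * min x 0) x := by
  rcases lt_trichotomy x 0 with hx | rfl | hx
  · have h : HasDerivAt (fun y : ℝ => y ^ 2) (2 * min x 0) x := by
      simpa [min_eq_left hx.le] using hasDerivAt_pow 2 x
    refine h.congr_of_eventuallyEq ?_
    filter_upwards [Iio_mem_nhds hx] with y hy
    rw [min_eq_left (le_of_lt hy)]
  · have h : HasDerivAt (fun y : ℝ => y ^ 2) 0 0 := by
      simpa using hasDerivAt_pow 2 (0 : ℝ)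
    rw [hasDerivAt_iff_isLittleO] at h ⊢
    refine Asymptotics.IsBigO.trans_isLittleO
      (Asymptotics.IsBigO.of_bound 1 (Filter.Eventually.of_forall fun y => ?_)) h
    rcases le_total y 0 with hy | hy <;> simp [hy]
  · have h : HasDerivAt (fun _ : ℝ => (0 : ℝ)) (2 * min x 0) x := by
      simpa [min_eq_right hx.le] using hasDerivAt_const x (0 : ℝ)
    refine h.congr_of_eventuallyEq ?_
    filter_upwards [Ioi_mem_nhds hx] with y hy
    simp [min_eq_right (Set.mem_Ioi.mp hy).le]

lemma continuous_fluidDrift (lam s mu th p q dRD dRC : ℝ) :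
    Continuous (fluidDrift lam s mu th p q dRD dRC) := by
  unfold fluidDrift
  fun_prop

lemma IsFluidSolution.hasDerivAt {lam s mu th p q dRD dRC : ℝ} {z : ℝ → ℝ × ℝ × ℝ}
    (hz : IsFluidSolution lam s mu th p q dRD dRC z) {t : ℝ} (ht : 0 < t) :
    HasDerivAt z (fluidDrift lam s mu th p q dRD dRC (z t)) t := by
  have hc : ContinuousOn (fun u => fluidDrift lam s mu th p q dRD dRC (z u)) (Set.Ici 0) :=
    (continuous_fluidDrift lam s mu th p q dRD dRC).comp_continuousOn hz.1
  have hi : IntervalIntegrable (fun u => fluidDrift lam s mu th p q dRD dRC (z u))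
      MeasureTheory.volume 0 t :=
    (hc.mono (by rw [Set.uIcc_of_le ht.le]; exact Set.Icc_subset_Ici_self)).intervalIntegrable
  have hd := intervalIntegral.integral_hasDerivAt_right hi
    ((hc.mono Set.Ioi_subset_Ici_self).stronglyMeasurableAtFilter isOpen_Ioi t ht)
    (hc.continuousAt (Ici_mem_nhds ht))
  refine (hd.const_add (z 0)).congr_of_eventuallyEq ?_
  filter_upwards [Ioi_mem_nhds ht] with u hu
  exact hz.2 u (le_of_lt hu)

/-- The squared distance to the nonnegative octant. -/
noncomputable def negPartSq (z : ℝ × ℝ × ℝ) : ℝ :=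
  (min z.1 0) ^ 2 + (min z.2.1 0) ^ 2 + (min z.2.2 0) ^ 2

lemma continuous_negPartSq : Continuous negPartSq := by
  unfold negPartSq
  fun_prop

lemma HasDerivAt.negPartSq {z : ℝ → ℝ × ℝ × ℝ} {z' : ℝ × ℝ × ℝ} {t : ℝ}
    (h : HasDerivAt z z' t) :
    HasDerivAt (fun u => negPartSq (z u))
      (2 * min (z t).1 0 * z'.1 + 2 * min (z t).2.1 0 * z'.2.1
        + 2 * min (z t).2.2 0 * z'.2.2) t := by
  have h1 : HasDerivAt (fun u => (z u).1) z'.1 t := h.fst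
  have h2 : HasDerivAt (fun u => (z u).2.1) z'.2.1 t := h.snd.fst
  have h3 : HasDerivAt (fun u => (z u).2.2) z'.2.2 t := h.snd.snd
  exact (((hasDerivAt_min_zero_sq _).comp t h1).add ((hasDerivAt_min_zero_sq _).comp t h2)).add
    ((hasDerivAt_min_zero_sq _).comp t h3)

/-- The one-sided growth estimate for the drift near the nonnegative octant. -/
lemma fluidDrift_negPartSq_le {lam s mu th p q dRD dRC : ℝ}
    (hlam : 0 ≤ lam) (hs : 0 ≤ s) (hmu : 0 ≤ mu) (hth : 0 ≤ th) (hp : 0 ≤ p) (hq : 0 ≤ q)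
    (hdRD : 0 ≤ dRD) (hdRC : 0 ≤ dRC) (z : ℝ × ℝ × ℝ) :
    2 * min z.1 0 * (fluidDrift lam s mu th p q dRD dRC z).1
      + 2 * min z.2.1 0 * (fluidDrift lam s mu th p q dRD dRC z).2.1
      + 2 * min z.2.2 0 * (fluidDrift lam s mu th p q dRD dRC z).2.2
      ≤ (dRD + dRC + q * mu) * negPartSq z := by
  obtain ⟨x, y, w⟩ := z
  simp only [fluidDrift, negPartSq]
  have hx : min x 0 ≤ 0 := min_le_right _ _
  have hy : min y 0 ≤ 0 := min_le_right _ _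
  have hw : min w 0 ≤ 0 := min_le_right _ _
  have hqm : 0 ≤ q * mu := mul_nonneg hq hmu
  have hmin : min x 0 ≤ min s x :=
    le_min ((min_le_right _ _).trans hs) (min_le_left _ _)
  have hserv : 0 ≤ min x 0 * min s x := by
    rcases le_total x 0 with h | h
    · rw [min_eq_left h, min_eq_right (h.trans hs)]; exact mul_self_nonneg x
    · simp [h]
  have haband : min x 0 * max (x - s) 0 = 0 := by
    rcases le_total x 0 with h | h
    · rw [max_eq_right (by linarith), mul_zero]
    · simp [h]
  have hself (v : ℝ) : 0 ≤ min v 0 * v := by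
    rcases le_total v 0 with h | h
    · rw [min_eq_left h]; exact mul_self_nonneg v
    · simp [h]
  have hxy : min x 0 * y ≤ min x 0 * min y 0 :=
    mul_le_mul_of_nonpos_left (min_le_left _ _) hx
  have hxw : min x 0 * w ≤ min x 0 * min w 0 :=
    mul_le_mul_of_nonpos_left (min_le_left _ _) hx
  have hwx : min w 0 * min s x ≤ min w 0 * min x 0 :=
    mul_le_mul_of_nonpos_left hmin hw
  have hyB : min y 0 * max (x - s) 0 ≤ 0 :=
    mul_nonpos_of_nonpos_of_nonneg hy (le_max_right _ _)
  have hyy := hself y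
  have hww := hself w
  generalize min x 0 = a at *
  generalize min y 0 = b at *
  generalize min w 0 = c at *
  generalize min s x = m at *
  generalize max (x - s) 0 = B at *
  have e1 : 2 * (a * y) ≤ a ^ 2 + b ^ 2 + c ^ 2 := by nlinarith [sq_nonneg (a - b), sq_nonneg c]
  have e2 : 2 * (a * w) ≤ a ^ 2 + b ^ 2 + c ^ 2 := by nlinarith [sq_nonneg (a - c), sq_nonneg b]
  have e3 : 2 * (c * m) ≤ a ^ 2 + b ^ 2 + c ^ 2 := by nlinarith [sq_nonneg (a - c), sq_nonneg b]
  have f1 := mul_le_mul_of_nonneg_left e1 hdRD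
  have f2 := mul_le_mul_of_nonneg_left e2 hdRC
  have f3 := mul_le_mul_of_nonneg_left e3 hqm
  have f4 := mul_nonneg hmu hserv
  have f5 := mul_nonpos_of_nonneg_of_nonpos (mul_nonneg hp hth) hyB
  have f6 := mul_nonneg hdRD hyy
  have f7 := mul_nonneg hdRC hww
  have f8 := mul_nonpos_of_nonneg_of_nonpos hlam hx
  have f9 : th * (a * B) = 0 := by rw [haband, mul_zero]
  linarith

/-- the nonnegative octant is invariant for the fluid dynamics. -/
theorem fluid_solution_nonneg (lam s mu th p q dRD dRC : ℝ)
    (hlam : 0 ≤ lam) (hs : 0 < s) (hmu : 0 < mu) (hth : 0 < th)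
    (hp0 : 0 ≤ p) (hp1 : p ≤ 1) (hq0 : 0 ≤ q) (hq1 : q < 1)
    (hdRD : 0 < dRD) (hdRC : 0 < dRC) (z : ℝ → ℝ × ℝ × ℝ)
    (hz : IsFluidSolution lam s mu th p q dRD dRC z)
    (hQ0 : 0 ≤ (z 0).1) (hRD0 : 0 ≤ (z 0).2.1) (hRC0 : 0 ≤ (z 0).2.2) :
    ∀ t : ℝ, 0 ≤ t → 0 ≤ (z t).1 ∧ 0 ≤ (z t).2.1 ∧ 0 ≤ (z t).2.2 := by
  set K := dRD + dRC + q * mu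
  have hderiv (t : ℝ) (ht : 0 < t) :=
    (hz.hasDerivAt ht).negPartSq.mul (((hasDerivAt_id t).const_mul (-K)).exp)
  have hanti : AntitoneOn (fun t => negPartSq (z t) * Real.exp (-K * t)) (Set.Ici 0) := by
    refine antitoneOn_of_deriv_nonpos (convex_Ici 0)
      ((continuous_negPartSq.comp_continuousOn hz.1).mul (by fun_prop)) ?_ ?_
    · rw [interior_Ici]
      exact fun t ht => (hderiv t ht).differentiableAt.differentiableWithinAt
    · rw [interior_Ici]
      intro t ht
      refine (hderiv t ht).deriv.trans_le ?_
      have hle := mul_le_mul_of_nonneg_right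
        (fluidDrift_negPartSq_le hlam hs.le hmu.le hth.le hp0 hq0 hdRD.le hdRC.le (z t))
        (Real.exp_nonneg (-K * t))
      simp only [id]
      linarith
  intro t ht
  have hle := hanti Set.self_mem_Ici ht ht
  have hzero : negPartSq (z 0) = 0 := by simp [negPartSq, hQ0, hRD0, hRC0]
  simp only [hzero, zero_mul] at hle
  have hV : negPartSq (z t) ≤ 0 := nonpos_of_mul_nonpos_left hle (Real.exp_pos _)
  unfold negPartSq at hV
  have h1 := sq_nonneg (min (z t).1 0)
  have h2 := sq_nonneg (min (z t).2.1 0)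
  have h3 := sq_nonneg (min (z t).2.2 0)
  have key (v : ℝ) (hv : (min v 0) ^ 2 ≤ 0) : 0 ≤ v :=
    min_eq_right_iff.mp (pow_eq_zero_iff two_ne_zero |>.mp (le_antisymm hv (sq_nonneg _)))
  exact ⟨key _ (by linarith), key _ (by linarith), key _ (by linarith)⟩
end

section
/- Suppose λ < (1 − q)·s·μ (underloaded fluid model, ρ̂ := λ/((1−q)·s·μ) < 1). Then the point (a, b, c) with a = λ/((1 − q)·μ), b = 0, and c = q·λ/((1 − q)·δ_RC) is a stationary point of the fluid model, i.e., H(a, b, c) = 0; moreover a < s, so in the stationary fluid model the queue content is strictly below the staffing level and the redial orbit is empty. -/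
/-- in the underloaded regime `λ < (1-q)sμ`, the point
`(λ/((1-q)μ), 0, qλ/((1-q)δ_RC))` is a stationary point and its first coordinate is `< s`. -/
theorem stationary_point_underloaded (lam s mu th p q dRD dRC : ℝ)
    (hlam : 0 ≤ lam) (hs : 0 < s) (hmu : 0 < mu) (hth : 0 < th)
    (hp0 : 0 ≤ p) (hp1 : p ≤ 1) (hq0 : 0 ≤ q) (hq1 : q < 1)
    (hdRD : 0 < dRD) (hdRC : 0 < dRC)
    (hload : lam < (1 - q) * s * mu) :
    fluidDrift lam s mu th p q dRD dRC
        (lam / ((1 - q) * mu), 0, q * lam / ((1 - q) * dRC)) = 0 ∧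
      lam / ((1 - q) * mu) < s := by
  have hq : 0 < 1 - q := by linarith
  have ha : lam / ((1 - q) * mu) < s := by
    rw [div_lt_iff₀ (by positivity)]
    linarith
  refine ⟨?_, ha⟩
  simp only [fluidDrift, min_eq_right ha.le, max_eq_right (sub_nonpos.2 ha.le)]
  refine Prod.ext ?_ (Prod.ext ?_ ?_) <;> simp only [Prod.fst_zero, Prod.snd_zero] <;>
    field_simp <;> ring
end

section
/- Suppose λ ≥ (1 − q)·s·μ (overloaded fluid model, ρ̂ := λ/((1−q)·s·μ) ≥ 1) and p < 1. Then the point (a, b, c) with a = s + (λ + q·μ·s − μ·s)/(θ·(1 − p)), b = p·(λ − (1 − q)·μ·s)/((1 − p)·δ_RD), and c = q·μ·s/δ_RC is a stationary point of the fluid model, i.e., H(a, b, c) = 0; moreover a ≥ s. -/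
/-- in the overloaded regime `λ ≥ (1-q)sμ` with `p < 1`, the point
`(s + (λ + qμs - μs)/(θ(1-p)), p(λ - (1-q)μs)/((1-p)δ_RD), qμs/δ_RC)` is stationary,
and its first coordinate is `≥ s`. -/
theorem stationary_point_overloaded (lam s mu th p q dRD dRC : ℝ)
    (hlam : 0 ≤ lam) (hs : 0 < s) (hmu : 0 < mu) (hth : 0 < th)
    (hp0 : 0 ≤ p) (hp1 : p < 1) (hq0 : 0 ≤ q) (hq1 : q < 1)
    (hdRD : 0 < dRD) (hdRC : 0 < dRC)
    (hload : (1 - q) * s * mu ≤ lam) :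
    fluidDrift lam s mu th p q dRD dRC
        (s + (lam + q * mu * s - mu * s) / (th * (1 - p)),
         p * (lam - (1 - q) * mu * s) / ((1 - p) * dRD),
         q * mu * s / dRC) = 0 ∧
      s ≤ s + (lam + q * mu * s - mu * s) / (th * (1 - p)) := by
  have hp : 0 < 1 - p := sub_pos.mpr hp1
  have hexcess : 0 ≤ (lam + q * mu * s - mu * s) / (th * (1 - p)) :=
    div_nonneg (by linarith) (by positivity)
  have hle : s ≤ s + (lam + q * mu * s - mu * s) / (th * (1 - p)) :=
    le_add_of_nonneg_right hexcess
  refine ⟨?_, hle⟩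
  simp only [fluidDrift, min_eq_left hle, add_sub_cancel_left, max_eq_left hexcess,
    Prod.mk_eq_zero]
  refine ⟨?_, ?_, ?_⟩ <;> field_simp <;> ring
end

section
/- Assume p < 1. Then the fluid model has exactly one stationary point (a, b, c) ∈ ℝ³ (solution of H(a,b,c)=0), given as follows: if λ < (1 − q)·s·μ then a = λ/((1 − q)·μ), b = 0, c = q·μ·a/δ_RC; and if λ ≥ (1 − q)·s·μ then a = s + (λ + q·μ·s − μ·s)/(θ·(1 − p)), b = p·θ·(a − s)/δ_RD, c = q·μ·s/δ_RC. -/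
/-- Stationarity amounts to the balance equation for the queue coordinate, the orbit
coordinates being determined by it. -/
theorem fluidDrift_eq_zero_iff {lam s mu th p q dRD dRC : ℝ} (hdRD : dRD ≠ 0) (hdRC : dRC ≠ 0)
    (a b c : ℝ) :
    fluidDrift lam s mu th p q dRD dRC (a, b, c) = 0 ↔
      (1 - q) * mu * min s a + (1 - p) * th * max (a - s) 0 = lam ∧
        b = p * th * max (a - s) 0 / dRD ∧ c = q * mu * min s a / dRC := by
  simp only [fluidDrift, Prod.mk_eq_zero, eq_div_iff hdRD, eq_div_iff hdRC]
  constructor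
  · rintro ⟨h1, h2, h3⟩
    exact ⟨by linarith, by linarith, by linarith⟩
  · rintro ⟨h1, h2, h3⟩
    exact ⟨by linarith, by linarith, by linarith⟩

/-- A positive combination of `min s x` and `max (x - s) 0` is strictly increasing in `x`. -/
theorem strictMono_mul_min_add_mul_max {k l : ℝ} (hk : 0 < k) (hl : 0 < l) (s : ℝ) :
    StrictMono fun x : ℝ => k * min s x + l * max (x - s) 0 := by
  intro x y hxy
  dsimp only
  rcases le_total s x with hx | hx
  · rw [min_eq_left hx, min_eq_left (hx.trans hxy.le), max_eq_left (by linarith),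
      max_eq_left (by linarith)]
    nlinarith
  · rw [min_eq_right hx, max_eq_right (by linarith)]
    rcases le_total s y with hy | hy
    · rw [min_eq_left hy, max_eq_left (by linarith)]
      rcases hx.lt_or_eq with h | h
      · nlinarith [mul_nonneg hl.le (sub_nonneg.2 hy)]
      · nlinarith
    · rw [min_eq_right hy, max_eq_right (by linarith)]
      nlinarith

/-- for `p < 1` the fluid model has exactly one stationary point, and it is
given by the explicit piecewise formulas. -/
theorem stationary_point_unique (lam s mu th p q dRD dRC : ℝ)
    (hlam : 0 ≤ lam) (hs : 0 < s) (hmu : 0 < mu) (hth : 0 < th)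
    (hp0 : 0 ≤ p) (hp1 : p < 1) (hq0 : 0 ≤ q) (hq1 : q < 1)
    (hdRD : 0 < dRD) (hdRC : 0 < dRC) :
    (∃! zp : ℝ × ℝ × ℝ, fluidDrift lam s mu th p q dRD dRC zp = 0) ∧
      (lam < (1 - q) * s * mu →
        fluidDrift lam s mu th p q dRD dRC
          (lam / ((1 - q) * mu), 0,
           q * mu * (lam / ((1 - q) * mu)) / dRC) = 0) ∧
      ((1 - q) * s * mu ≤ lam →
        fluidDrift lam s mu th p q dRD dRC
          (s + (lam + q * mu * s - mu * s) / (th * (1 - p)),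
           p * th * ((s + (lam + q * mu * s - mu * s) / (th * (1 - p))) - s) / dRD,
           q * mu * s / dRC) = 0) := by
  have hq : 0 < 1 - q := sub_pos.2 hq1
  have hp : 0 < 1 - p := sub_pos.2 hp1
  have h_underload : lam < (1 - q) * s * mu →
      fluidDrift lam s mu th p q dRD dRC
        (lam / ((1 - q) * mu), 0, q * mu * (lam / ((1 - q) * mu)) / dRC) = 0 := by
    intro h
    have ha : lam / ((1 - q) * mu) ≤ s := by
      rw [div_le_iff₀ (by positivity)]
      linarith
    rw [fluidDrift_eq_zero_iff hdRD.ne' hdRC.ne', min_eq_right ha,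
      max_eq_right (sub_nonpos.2 ha)]
    refine ⟨?_, by simp, rfl⟩
    field_simp
    ring
  have h_overload : (1 - q) * s * mu ≤ lam →
      fluidDrift lam s mu th p q dRD dRC
        (s + (lam + q * mu * s - mu * s) / (th * (1 - p)),
         p * th * ((s + (lam + q * mu * s - mu * s) / (th * (1 - p))) - s) / dRD,
         q * mu * s / dRC) = 0 := by
    intro h
    have ha : 0 ≤ (lam + q * mu * s - mu * s) / (th * (1 - p)) :=
      div_nonneg (by linarith) (by positivity)
    rw [fluidDrift_eq_zero_iff hdRD.ne' hdRC.ne', min_eq_left (by linarith),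
      max_eq_left (by linarith)]
    refine ⟨?_, rfl, rfl⟩
    field_simp
    ring
  refine ⟨existsUnique_of_exists_of_unique ?_ ?_, h_underload, h_overload⟩
  · rcases lt_or_ge lam ((1 - q) * s * mu) with h | h
    · exact ⟨_, h_underload h⟩
    · exact ⟨_, h_overload h⟩
  · rintro ⟨a, b, c⟩ ⟨a', b', c'⟩ h h'
    rw [fluidDrift_eq_zero_iff hdRD.ne' hdRC.ne'] at h h'
    obtain ⟨h, rfl, rfl⟩ := h
    obtain ⟨h', rfl, rfl⟩ := h'
    obtain rfl : a = a' :=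
      (strictMono_mul_min_add_mul_max (mul_pos hq hmu) (mul_pos hp hth) s).injective
        (h.trans h'.symm)
    rfl
end

section
/- Assume 0 < p < 1, and let (a, b, c) be a stationary point of the fluid model (H(a,b,c)=0). Then the redial orbit content b equals 0 if and only if λ ≤ (1 − q)·s·μ; equivalently, the stationary fluid redial orbit is nonempty exactly when the offered load ρ̂ := λ/((1−q)·s·μ) exceeds 1. -/
/-- for `0 < p < 1`, the stationary redial orbit is empty iff the system
is not overloaded, i.e. `b = 0 ↔ λ ≤ (1-q)sμ`. -/
theorem stationary_redial_orbit_empty_iff (lam s mu th p q dRD dRC : ℝ)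
    (hlam : 0 ≤ lam) (hs : 0 < s) (hmu : 0 < mu) (hth : 0 < th)
    (hp0 : 0 < p) (hp1 : p < 1) (hq0 : 0 ≤ q) (hq1 : q < 1)
    (hdRD : 0 < dRD) (hdRC : 0 < dRC) (a b c : ℝ)
    (hstat : fluidDrift lam s mu th p q dRD dRC (a, b, c) = 0) :
    b = 0 ↔ lam ≤ (1 - q) * s * mu := by
  simp only [fluidDrift, Prod.mk_eq_zero] at hstat
  obtain ⟨h_fresh, h_redial, h_reconnect⟩ := hstat
  have h_balance : lam = (1 - q) * mu * min s a + (1 - p) * th * max (a - s) 0 := by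
    linear_combination h_fresh + h_redial + h_reconnect
  rcases le_or_gt a s with h | h
  · rw [max_eq_right (sub_nonpos.2 h)] at h_redial h_balance
    rw [min_eq_right h] at h_balance
    have hb : b = 0 := by
      have : dRD * b = 0 := by linarith
      exact (mul_eq_zero.1 this).resolve_left hdRD.ne'
    have hle : (1 - q) * mu * a ≤ (1 - q) * mu * s :=
      mul_le_mul_of_nonneg_left h (mul_nonneg (sub_nonneg.2 hq1.le) hmu.le)
    exact iff_of_true hb (by linarith)
  · have has : 0 < a - s := sub_pos.2 h
    rw [max_eq_left has.le] at h_redial h_balance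
    rw [min_eq_left h.le] at h_balance
    have hb : b ≠ 0 := by
      rintro rfl
      have : 0 < p * th * (a - s) := by positivity
      linarith
    have hpos : 0 < (1 - p) * th * (a - s) :=
      mul_pos (mul_pos (sub_pos.2 hp1) hth) has
    exact iff_of_false hb (by linarith)
end

section
/- Suppose λ < (1 − q)·s·μ and let (a, b, c) be a stationary point of the fluid model (H(a,b,c)=0) with a ≤ s. Then the stationary total fluid arrival rate (fresh plus redial plus reconnect) satisfies λ + δ_RD·b + δ_RC·c = λ/(1 − q); that is, reconnects inflate the fresh arrival rate by the factor 1/(1 − q) in the underloaded regime. -/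
/-- in the underloaded regime, the stationary total fluid arrival rate
equals `λ/(1-q)`. -/
theorem stationary_total_arrival_rate_underloaded (lam s mu th p q dRD dRC : ℝ)
    (hlam : 0 ≤ lam) (hs : 0 < s) (hmu : 0 < mu) (hth : 0 < th)
    (hp0 : 0 ≤ p) (hp1 : p ≤ 1) (hq0 : 0 ≤ q) (hq1 : q < 1)
    (hdRD : 0 < dRD) (hdRC : 0 < dRC)
    (hload : lam < (1 - q) * s * mu) (a b c : ℝ)
    (hstat : fluidDrift lam s mu th p q dRD dRC (a, b, c) = 0) (ha : a ≤ s) :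
    lam + dRD * b + dRC * c = lam / (1 - q) := by
  simp only [fluidDrift, Prod.mk_eq_zero, min_eq_right ha,
    max_eq_right (sub_nonpos.mpr ha)] at hstat
  obtain ⟨h_total, h_redial, h_reconnect⟩ := hstat
  rw [eq_div_iff (by linarith)]
  linear_combination -q * h_total - h_redial - h_reconnect
end

section
/- Suppose λ ≥ (1 − q)·s·μ and p < 1, and let (a, b, c) be the stationary point of the fluid model with a ≥ s. Then the stationary fluid abandonment rate satisfies θ·(a − s) = (λ − (1 − q)·s·μ)/(1 − p), and the stationary inflow rate into the redial orbit satisfies p·θ·(a − s) = δ_RD·b = p·(λ − (1 − q)·s·μ)/(1 − p). -/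
/-- in the overloaded regime with `p < 1`, the stationary fluid abandonment
rate is `(λ - (1-q)sμ)/(1-p)`, and the stationary inflow rate into the redial orbit is
`p(λ - (1-q)sμ)/(1-p)`. -/
theorem stationary_abandonment_rate_overloaded (lam s mu th p q dRD dRC : ℝ)
    (hlam : 0 ≤ lam) (hs : 0 < s) (hmu : 0 < mu) (hth : 0 < th)
    (hp0 : 0 ≤ p) (hp1 : p < 1) (hq0 : 0 ≤ q) (hq1 : q < 1)
    (hdRD : 0 < dRD) (hdRC : 0 < dRC)
    (hload : (1 - q) * s * mu ≤ lam) (a b c : ℝ)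
    (hstat : fluidDrift lam s mu th p q dRD dRC (a, b, c) = 0) (ha : s ≤ a) :
    th * (a - s) = (lam - (1 - q) * s * mu) / (1 - p) ∧
      p * th * (a - s) = dRD * b ∧
      dRD * b = p * (lam - (1 - q) * s * mu) / (1 - p) := by
  have hne : 1 - p ≠ 0 := by linarith
  simp only [fluidDrift, min_eq_left ha, max_eq_left (sub_nonneg.mpr ha), Prod.mk_eq_zero] at hstat
  obtain ⟨hQ, hRD, hRC⟩ := hstat
  have hrate : th * (a - s) = (lam - (1 - q) * s * mu) / (1 - p) := by
    rw [eq_div_iff hne]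
    linarith
  have hinflow : p * th * (a - s) = dRD * b := by linarith
  refine ⟨hrate, hinflow, ?_⟩
  rw [← hinflow, mul_assoc, hrate, mul_div_assoc]
end

section
/- Multiple-interval fluid model: let 0 = t₀ < t₁ < ⋯ < t_m, and for each i ∈ {1, …, m} let λᵢ ≥ 0 and sᵢ > 0 be the fresh arrival rate and staffing level on [t_{i−1}, t_i). Define the time-dependent drift G(t, z) = H_{λᵢ, sᵢ}(z) for t ∈ [t_{i−1}, t_i), where H_{λ, s} is the fluid drift map with parameters (λ, s). Then for every initial state z⁰ ∈ ℝ³ there exists a unique continuous function z : [0, t_m] → ℝ³ satisfying z(t) = z⁰ + ∫₀ᵗ G(u, z(u)) du for all t ∈ [0, t_m]. -/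
open MeasureTheory Set in
/-- `z` is a continuous solution on `[a, b]` of the integral equation
`z τ = x + ∫ u in a..τ, G u (z u)`. -/
def IsIntegralSolution {E : Type*} [NormedAddCommGroup E] [NormedSpace ℝ E]
    (G : ℝ → E → E) (a b : ℝ) (x : E) (z : ℝ → E) : Prop :=
  ContinuousOn z (Icc a b) ∧ ∀ τ ∈ Icc a b, z τ = x + ∫ u in a..τ, G u (z u)

open MeasureTheory Set in
/-- The integral equation with drift `G` has a unique solution on `[a, b]` for each initial value,
and `G` is integrable along continuous paths. -/
structure IntegralWellPosed {E : Type*} [NormedAddCommGroup E] [NormedSpace ℝ E]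
    (G : ℝ → E → E) (a b : ℝ) : Prop where
  intervalIntegrable : ∀ z : ℝ → E, ContinuousOn z (Icc a b) →
    IntervalIntegrable (fun u => G u (z u)) volume a b
  exists_solution : ∀ x, ∃ z, IsIntegralSolution G a b x z
  unique : ∀ x z w, IsIntegralSolution G a b x z → IsIntegralSolution G a b x w →
    EqOn w z (Icc a b)

section IntegralEquation

open MeasureTheory Set
open scoped NNReal

theorem intervalIntegrable_of_eqOn_Ico {E : Type*} [NormedAddCommGroup E]
    {f g : ℝ → E} {a b : ℝ} (hab : a ≤ b)
    (hf : IntervalIntegrable f volume a b) (h : EqOn f g (Ico a b)) :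
    IntervalIntegrable g volume a b := by
  rw [intervalIntegrable_iff_integrableOn_Ico_of_le hab] at hf ⊢
  exact hf.congr_fun h measurableSet_Ico

variable {E : Type*} [NormedAddCommGroup E] [NormedSpace ℝ E] {G : ℝ → E → E} {a b c : ℝ}

theorem IsIntegralSolution.left {x : E} {z : ℝ → E} (h : IsIntegralSolution G a c x z)
    (hbc : b ≤ c) : IsIntegralSolution G a b x z :=
  ⟨h.1.mono (Icc_subset_Icc_right hbc), fun τ hτ => h.2 τ ⟨hτ.1, hτ.2.trans hbc⟩⟩

theorem intervalIntegral_congr_Ico {f g : ℝ → E} (hab : a ≤ b) (h : EqOn f g (Ico a b)) :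
    ∫ u in a..b, f u = ∫ u in a..b, g u := by
  rw [intervalIntegral.integral_of_le hab, intervalIntegral.integral_of_le hab,
    ← integral_Ico_eq_integral_Ioc, ← integral_Ico_eq_integral_Ioc]
  exact setIntegral_congr_fun measurableSet_Ico h

theorem IntegralWellPosed.integrable_subinterval (h : IntegralWellPosed G a b) {z : ℝ → E}
    (hz : ContinuousOn z (Icc a b)) {τ : ℝ} (hτ : τ ∈ Icc a b) :
    IntervalIntegrable (fun u => G u (z u)) volume a τ :=
  (h.intervalIntegrable z hz).mono_set (by
    rw [uIcc_of_le hτ.1, uIcc_of_le (hτ.1.trans hτ.2)]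
    exact Icc_subset_Icc_right hτ.2)

theorem IntegralWellPosed.isIntegralSolution_right (hab : a ≤ b) (hbc : b ≤ c)
    (h₁ : IntegralWellPosed G a b) (h₂ : IntegralWellPosed G b c) {x : E} {z : ℝ → E}
    (hz : IsIntegralSolution G a c x z) : IsIntegralSolution G b c (z b) z := by
  have hc := hz.1.mono (Icc_subset_Icc_left hab)
  refine ⟨hc, fun τ hτ => ?_⟩
  rw [hz.2 τ ⟨hab.trans hτ.1, hτ.2⟩, hz.2 b ⟨hab, hbc⟩, add_assoc,
    intervalIntegral.integral_add_adjacent_intervals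
      (h₁.intervalIntegrable z (hz.left hbc).1) (h₂.integrable_subinterval hc hτ)]

theorem IntegralWellPosed.trans (hab : a ≤ b) (hbc : b ≤ c)
    (h₁ : IntegralWellPosed G a b) (h₂ : IntegralWellPosed G b c) : IntegralWellPosed G a c where
  intervalIntegrable z hz :=
    (h₁.intervalIntegrable z (hz.mono (Icc_subset_Icc_right hbc))).trans
      (h₂.intervalIntegrable z (hz.mono (Icc_subset_Icc_left hab)))
  exists_solution x := by
    obtain ⟨z₁, hz₁⟩ := h₁.exists_solution x
    obtain ⟨z₂, hz₂⟩ := h₂.exists_solution (z₁ b)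
    have hb : z₂ b = z₁ b := by simpa using hz₂.2 b ⟨le_rfl, hbc⟩
    classical
    let z : ℝ → E := fun u => if u ≤ b then z₁ u else z₂ u
    have e₁ : EqOn z z₁ (Icc a b) := fun u hu => if_pos hu.2
    have e₂ : EqOn z z₂ (Icc b c) := fun u hu => by
      rcases hu.1.eq_or_lt with rfl | h
      · simp [z, hb]
      · simp [z, not_le.2 h]
    have c₁ := hz₁.1.congr e₁
    have c₂ := hz₂.1.congr e₂
    have s₁ : ∀ τ ∈ Icc a b, z τ = x + ∫ u in a..τ, G u (z u) := fun τ hτ => by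
      rw [e₁ hτ, hz₁.2 τ hτ, intervalIntegral_congr_Ico hτ.1]
      intro u hu
      simp only [e₁ ⟨hu.1, hu.2.le.trans hτ.2⟩]
    refine ⟨z, ?_, fun τ hτ => ?_⟩
    · rw [← Icc_union_Icc_eq_Icc hab hbc]
      exact c₁.union_of_isClosed c₂ isClosed_Icc isClosed_Icc
    · rcases le_total τ b with h | h
      · exact s₁ τ ⟨hτ.1, h⟩
      · have hτ' : τ ∈ Icc b c := ⟨h, hτ.2⟩
        rw [← intervalIntegral.integral_add_adjacent_intervals
          (h₁.intervalIntegrable z c₁) (h₂.integrable_subinterval c₂ hτ'), ← add_assoc,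
          ← s₁ b ⟨hab, le_rfl⟩, e₂ hτ', hz₂.2 τ hτ', e₁ ⟨hab, le_rfl⟩]
        congr 1
        refine intervalIntegral_congr_Ico h fun u hu => ?_
        simp only [e₂ ⟨hu.1, hu.2.le.trans hτ.2⟩]
  unique x z w hz hw := by
    have e₁ := h₁.unique x z w (hz.left hbc) (hw.left hbc)
    have hz₂ := h₁.isIntegralSolution_right hab hbc h₂ hz
    have hw₂ := h₁.isIntegralSolution_right hab hbc h₂ hw
    rw [e₁ ⟨hab, le_rfl⟩] at hw₂
    have e₂ := h₂.unique _ z w hz₂ hw₂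
    rw [← Icc_union_Icc_eq_Icc hab hbc]
    exact e₁.union e₂

theorem IntegralWellPosed.of_eqOn_Ico {F : ℝ → E → E} (hab : a ≤ b)
    (h : IntegralWellPosed F a b) (hFG : EqOn F G (Ico a b)) : IntegralWellPosed G a b := by
  have key : ∀ x z, IsIntegralSolution G a b x z ↔ IsIntegralSolution F a b x z := by
    intro x z
    refine and_congr_right fun _ => forall₂_congr fun τ hτ => ?_
    rw [intervalIntegral_congr_Ico (g := fun u => F u (z u)) hτ.1]
    intro u hu
    simp only [hFG ⟨hu.1, hu.2.trans_le hτ.2⟩]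
  refine ⟨fun z hz => intervalIntegrable_of_eqOn_Ico hab (h.intervalIntegrable z hz)
    fun u hu => by simp only [hFG hu], ?_, ?_⟩
  · simpa only [key] using h.exists_solution
  · simpa only [key] using h.unique

theorem LipschitzWith.integralWellPosed_of_mul_lt_one [CompleteSpace E] {f : E → E} {K : ℝ≥0}
    (hf : LipschitzWith K f) (hab : a ≤ b) (hK : K * (b - a) < 1) :
    IntegralWellPosed (fun _ => f) a b := by
  have hint : ∀ z : ℝ → E, ContinuousOn z (Icc a b) →
      IntervalIntegrable (fun u => f (z u)) volume a b := fun z hz =>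
    (hf.continuous.comp_continuousOn hz).intervalIntegrable_of_Icc hab
  have hcont : ∀ z : C(Icc a b, E), Continuous (fun u => f (IccExtend hab z u)) := fun z =>
    hf.continuous.comp (z.continuous.Icc_extend')
  let Φ : E → C(Icc a b, E) → C(Icc a b, E) := fun x z =>
    ⟨fun τ => x + ∫ u in a..τ, f (IccExtend hab z u),
      continuous_const.add ((intervalIntegral.continuous_primitive
        (fun _ _ => (hcont z).intervalIntegrable _ _) a).comp continuous_subtype_val)⟩
  have hfix : ∀ x (z : C(Icc a b, E)),
      Φ x z = z ↔ IsIntegralSolution (fun _ => f) a b x (IccExtend hab z) := by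
    intro x z
    constructor
    · intro h
      refine ⟨z.continuous.Icc_extend'.continuousOn, fun τ hτ => ?_⟩
      rw [IccExtend_of_mem hab z hτ]
      exact (DFunLike.congr_fun h ⟨τ, hτ⟩).symm
    · intro h
      ext τ
      have := h.2 τ τ.2
      rw [IccExtend_val] at this
      exact this.symm
  have hlip : ∀ x, ContractingWith (K * Real.toNNReal (b - a)) (Φ x) := by
    intro x
    have hba : 0 ≤ b - a := sub_nonneg.2 hab
    refine ⟨?_, LipschitzWith.of_dist_le_mul fun z w => ?_⟩
    · rw [← NNReal.coe_lt_coe]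
      simpa [Real.coe_toNNReal _ hba] using hK
    · rw [ContinuousMap.dist_le (by positivity)]
      intro τ
      have hτ := τ.2
      change dist (x + ∫ u in a..τ, f (IccExtend hab z u))
        (x + ∫ u in a..τ, f (IccExtend hab w u)) ≤ _
      rw [dist_add_left, dist_eq_norm, ← intervalIntegral.integral_sub
        ((hcont z).intervalIntegrable _ _) ((hcont w).intervalIntegrable _ _)]
      have hle : ‖∫ u in a..τ, f (IccExtend hab z u) - f (IccExtend hab w u)‖
          ≤ K * dist z w * |(τ : ℝ) - a| := by
        refine intervalIntegral.norm_integral_le_of_norm_le_const fun u _ => ?_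
        rw [← dist_eq_norm]
        refine (hf.dist_le_mul _ _).trans ?_
        gcongr
        exact ContinuousMap.dist_apply_le_dist _
      refine hle.trans ?_
      rw [abs_of_nonneg (sub_nonneg.2 hτ.1), NNReal.coe_mul, Real.coe_toNNReal _ hba,
        mul_right_comm]
      gcongr
      exact hτ.2
  refine ⟨hint, fun x => ?_, fun x z w hz hw => ?_⟩
  · have : Nonempty C(Icc a b, E) := ⟨ContinuousMap.const _ x⟩
    exact ⟨_, (hfix x _).1 (hlip x).fixedPoint_isFixedPt⟩
  · have restrict_fixed : ∀ (y : ℝ → E) (hy : IsIntegralSolution (fun _ => f) a b x y),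
        Φ x ⟨_, hy.1.domRestrict⟩ = ⟨_, hy.1.domRestrict⟩ := by
      intro y hy
      have e : EqOn (IccExtend hab ((Icc a b).domRestrict y)) y (Icc a b) := fun u hu => by
        rw [IccExtend_of_mem hab _ hu, domRestrict_apply]
      rw [hfix]
      refine ⟨hy.1.congr e, fun τ hτ => ?_⟩
      refine (e hτ).trans ((hy.2 τ hτ).trans ?_)
      congr 1
      refine intervalIntegral_congr_Ico hτ.1 fun u hu => ?_
      exact congrArg f (e ⟨hu.1, hu.2.le.trans hτ.2⟩).symm
    have := (hlip x).fixedPoint_unique' (restrict_fixed w hw) (restrict_fixed z hz)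
    intro τ hτ
    exact DFunLike.congr_fun this ⟨τ, hτ⟩

theorem LipschitzWith.integralWellPosed [CompleteSpace E] {f : E → E} {K : ℝ≥0}
    (hf : LipschitzWith K f) (hab : a ≤ b) : IntegralWellPosed (fun _ => f) a b := by
  obtain ⟨h, hh, hKh⟩ : ∃ h : ℝ, 0 < h ∧ K * h < 1 :=
    ⟨1 / (K + 1), by positivity, by
      rw [mul_one_div, div_lt_one (by positivity)]
      exact lt_add_one _⟩
  obtain ⟨n, hn⟩ := exists_nat_ge ((b - a) / h)
  rw [div_le_iff₀ hh] at hn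
  induction n generalizing b with
  | zero =>
    refine hf.integralWellPosed_of_mul_lt_one hab ?_
    have : b - a = 0 := le_antisymm (by simpa using hn) (sub_nonneg.2 hab)
    simp [this]
  | succ n ih =>
    have hc : a ≤ max a (b - h) := le_max_left _ _
    have hcb : max a (b - h) ≤ b := max_le hab (by linarith)
    refine (ih hc ?_).trans hc hcb (hf.integralWellPosed_of_mul_lt_one hcb ?_)
    · push_cast at hn
      rw [sub_le_iff_le_add]
      refine max_le ?_ (by linarith)
      have : 0 ≤ n * h := by positivity
      linarith
    · refine lt_of_le_of_lt (mul_le_mul_of_nonneg_left ?_ K.2) hKh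
      linarith [le_max_right a (b - h)]

end IntegralEquation

theorem exists_lipschitzWith_fluidDrift (lam s mu th p q dRD dRC : ℝ) :
    ∃ K, LipschitzWith K (fluidDrift lam s mu th p q dRD dRC) := by
  have hmul : ∀ (c : ℝ) {K : NNReal} {g : ℝ × ℝ × ℝ → ℝ}, LipschitzWith K g →
      LipschitzWith (‖c‖₊ * K) (fun z => c * g z) := fun c _ _ hg => (lipschitzWith_smul c).comp hg
  have h₁ : LipschitzWith 1 (fun z : ℝ × ℝ × ℝ => z.1) := LipschitzWith.prod_fst
  have h₂ := LipschitzWith.prod_fst.comp (LipschitzWith.prod_snd (α := ℝ) (β := ℝ × ℝ))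
  have h₃ := LipschitzWith.prod_snd.comp (LipschitzWith.prod_snd (α := ℝ) (β := ℝ × ℝ))
  have hmin := h₁.const_min s
  have hmax := (h₁.sub (LipschitzWith.const s)).max_const 0
  exact ⟨_, (((((LipschitzWith.const lam).add (hmul dRD h₂)).add (hmul dRC h₃)).sub
    (hmul mu hmin)).sub (hmul th hmax)).prodMk
      (((hmul (p * th) hmax).sub (hmul dRD h₂)).prodMk
        ((hmul (q * mu) hmin).sub (hmul dRC h₃)))⟩

/-- multiple-interval fluid model. With piecewise-constant parameters
`λᵢ, sᵢ` on the intervals `[t_{i-1}, t_i)` of a partition `0 = t₀ < t₁ < ⋯ < t_m`, the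
time-dependent fluid integral equation has a unique continuous solution on `[0, t_m]`. -/
theorem fluid_limit_multiple_intervals (mu th p q dRD dRC : ℝ)
    (hmu : 0 < mu) (hth : 0 < th) (hp0 : 0 ≤ p) (hp1 : p ≤ 1)
    (hq0 : 0 ≤ q) (hq1 : q < 1) (hdRD : 0 < dRD) (hdRC : 0 < dRC)
    (m : ℕ) (hm : 0 < m) (t : Fin (m + 1) → ℝ) (ht0 : t 0 = 0) (htmono : StrictMono t)
    (lam sv : Fin m → ℝ) (hlam : ∀ i, 0 ≤ lam i) (hsv : ∀ i, 0 < sv i)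
    (G : ℝ → (ℝ × ℝ × ℝ) → ℝ × ℝ × ℝ)
    (hG : ∀ i : Fin m, ∀ u ∈ Set.Ico (t i.castSucc) (t i.succ), ∀ zz,
      G u zz = fluidDrift (lam i) (sv i) mu th p q dRD dRC zz)
    (z0 : ℝ × ℝ × ℝ) :
    ∃ z : ℝ → ℝ × ℝ × ℝ,
      (ContinuousOn z (Set.Icc 0 (t (Fin.last m))) ∧
        ∀ τ ∈ Set.Icc (0:ℝ) (t (Fin.last m)),
          z τ = z0 + ∫ u in (0:ℝ)..τ, G u (z u)) ∧
      ∀ w : ℝ → ℝ × ℝ × ℝ,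
        (ContinuousOn w (Set.Icc 0 (t (Fin.last m))) ∧
          ∀ τ ∈ Set.Icc (0:ℝ) (t (Fin.last m)),
            w τ = z0 + ∫ u in (0:ℝ)..τ, G u (w u)) →
        ∀ τ ∈ Set.Icc (0:ℝ) (t (Fin.last m)), w τ = z τ := by
  have hwp : ∀ i : Fin (m + 1), IntegralWellPosed G (t 0) (t i) := by
    intro i
    induction i using Fin.induction with
    | zero =>
      exact ((LipschitzWith.const (0 : ℝ × ℝ × ℝ)).integralWellPosed le_rfl).of_eqOn_Ico le_rfl
        (by simp)
    | succ i ih =>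
      obtain ⟨K, hK⟩ := exists_lipschitzWith_fluidDrift (lam i) (sv i) mu th p q dRD dRC
      have hi : t i.castSucc ≤ t i.succ := htmono.monotone i.castSucc_lt_succ.le
      exact ih.trans (htmono.monotone (Fin.zero_le _)) hi
        ((hK.integralWellPosed hi).of_eqOn_Ico hi fun u hu => funext fun zz => (hG i u hu zz).symm)
  have hlast := hwp (Fin.last m)
  rw [ht0] at hlast
  obtain ⟨z, hz⟩ := hlast.exists_solution z0
  exact ⟨z, hz, fun w hw => hlast.unique z0 z w hz hw⟩
end
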